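/- Let μ, ν ∈ ℝ and let f : [0,∞) → ℝ be continuously differentiable with f and f' bounded and f(x) → 0 as x → ∞. Define u¹(t,x) = ∫₀^∞ f(y) G(t;x,y) dy and u²(t,x) = ∫₀^∞ f'(y) H(t;x,y) dy for t > 0 and x ≥ 0. Then the function (t,x) ↦ ∂_x u¹(t,x) − ∂_x u²(t,x) on (0,∞) × [0,∞) converges to f'(0) as (t,x) → (0,0); in particular, even though ∂_x u¹ and ∂_x u² may each fail to be continuous at (0,0), their difference extends continuously to (0,0). -/

import Mathlib

open MeasureTheory Set Filter

/-- Standard normal density. -/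
noncomputable def phi (x : ℝ) : ℝ := (1 / Real.sqrt (2 * Real.pi)) * Real.exp (-x ^ 2 / 2)

/-- Standard normal tail function. -/
noncomputable def Psi (x : ℝ) : ℝ := ∫ y in Set.Ioi x, phi y

/-- The kernel `G(t;x,y)` with drift parameter `μ`. -/
noncomputable def Gker (μ t x y : ℝ) : ℝ :=
  (1 / Real.sqrt t) *
      (Real.exp (2 * μ * y) * phi ((x + y + μ * t) / Real.sqrt t) +
        phi ((x - y + μ * t) / Real.sqrt t)) -
    2 * μ * Real.exp (2 * μ * y) * Psi ((x + y + μ * t) / Real.sqrt t)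

/-- The kernel `H(t;x,y)` with parameters `μ, ν`. -/
noncomputable def Hker (μ ν t x y : ℝ) : ℝ :=
  if ν = μ then
    2 * Real.exp (2 * μ * y) *
      ((1 + μ * (x + y + μ * t)) * Psi ((x + y + μ * t) / Real.sqrt t) -
        μ * Real.sqrt t * phi ((x + y + μ * t) / Real.sqrt t))
  else
    Real.exp (2 * μ * y) / (ν - μ) *
      ((2 * ν - μ) * Real.exp (2 * (ν - μ) * (x + y + ν * t)) *
          Psi ((x + y + (2 * ν - μ) * t) / Real.sqrt t) -
        μ * Psi ((x + y + μ * t) / Real.sqrt t))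

/-- The density `g(t;b,s)` of `(B_t^{-μ}, S_t^{-μ})`, vanishing off `{b ≤ s, 0 ≤ s}`. -/
noncomputable def gker (μ t b s : ℝ) : ℝ :=
  if b ≤ s ∧ 0 ≤ s then
    Real.sqrt (2 / Real.pi) * t ^ (-(3 : ℝ) / 2) * (2 * s - b) *
      Real.exp (-(2 * s - b) ^ 2 / (2 * t) - μ * (b + μ * t / 2))
  else 0

/-- Spatial derivative (one-sided at `x = 0`). -/
noncomputable def ux (u : ℝ → ℝ → ℝ) (t x : ℝ) : ℝ :=
  derivWithin (fun z => u t z) (Set.Ici 0) x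

/-- Second spatial derivative (one-sided at `x = 0`). -/
noncomputable def uxx (u : ℝ → ℝ → ℝ) (t x : ℝ) : ℝ :=
  derivWithin (fun z => ux u t z) (Set.Ici 0) x

/-- Time derivative. -/
noncomputable def ut (u : ℝ → ℝ → ℝ) (t x : ℝ) : ℝ :=
  deriv (fun s => u s x) t

/-- `u` is a solution of the Stroock–Williams problem with parameters `μ, ν`
and initial data `f`. -/
def IsSWSolution (μ ν : ℝ) (f : ℝ → ℝ) (u : ℝ → ℝ → ℝ) : Prop :=
  ContDiffOn ℝ (⊤ : ℕ∞) (fun p : ℝ × ℝ => u p.1 p.2) (Set.Ioi 0 ×ˢ Set.Ici 0) ∧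
  (∀ T > (0 : ℝ),
    ContinuousOn (fun p : ℝ × ℝ => u p.1 p.2) (Set.Icc 0 T ×ˢ Set.Ici 0) ∧
    ContinuousOn (fun p : ℝ × ℝ => ux u p.1 p.2) (Set.Icc 0 T ×ˢ Set.Ici 0) ∧
    ∃ C : ℝ, ∀ p ∈ Set.Icc (0 : ℝ) T ×ˢ Set.Ici (0 : ℝ),
      |u p.1 p.2| ≤ C ∧ |ux u p.1 p.2| ≤ C) ∧
  (∀ t > (0 : ℝ), Filter.Tendsto (fun x => u t x) Filter.atTop (nhds 0)) ∧
  (∀ t > (0 : ℝ), ∀ x ≥ (0 : ℝ), ut u t x = μ * ux u t x + (1 / 2) * uxx u t x) ∧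
  (∀ x ≥ (0 : ℝ), u 0 x = f x) ∧
  (∀ t > (0 : ℝ), ut u t 0 = ν * ux u t 0)

/-- `f` is admissible initial data: `C¹` on `[0,∞)` with `f` and `f'` bounded
and `f(x) → 0` as `x → ∞`. -/
def IsInitialData (f : ℝ → ℝ) : Prop :=
  ContDiffOn ℝ 1 f (Set.Ici 0) ∧
  (∃ C : ℝ, ∀ x ∈ Set.Ici (0 : ℝ), |f x| ≤ C ∧ |derivWithin f (Set.Ici 0) x| ≤ C) ∧
  Filter.Tendsto f Filter.atTop (nhds 0)


lemma phi_nonneg (z : ℝ) : 0 ≤ phi z := by unfold phi; positivity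

lemma phi_neg (z : ℝ) : phi (-z) = phi z := by simp [phi]

lemma continuous_phi : Continuous phi := by unfold phi; fun_prop

lemma hasDerivAt_phi (z : ℝ) : HasDerivAt phi (-(z * phi z)) z := by
  have h : HasDerivAt (fun z : ℝ => -z ^ 2 / 2) (-z) z :=
    ((hasDerivAt_pow 2 z).neg.div_const 2).congr_deriv (by push_cast; ring)
  exact (h.exp.const_mul (1 / Real.sqrt (2 * Real.pi))).congr_deriv (by unfold phi; ring)

lemma phi_add (z l : ℝ) : phi (z + l) = phi z * Real.exp (-l * z - l ^ 2 / 2) := by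
  unfold phi
  rw [mul_assoc, ← Real.exp_add]
  congr 2
  ring

lemma integrable_phi : Integrable phi := by
  have := (integrable_exp_neg_mul_sq (b := 1 / 2) (by norm_num)).const_mul
    (1 / Real.sqrt (2 * Real.pi))
  refine this.congr (Eventually.of_forall fun z => ?_)
  simp only [phi]
  congr 2
  ring

lemma integral_phi : ∫ z, phi z = 1 := by
  have h : ∀ z, phi z = (1 / Real.sqrt (2 * Real.pi)) * Real.exp (-(1 / 2) * z ^ 2) := by
    intro z
    unfold phi
    congr 2
    ring
  simp_rw [h]
  rw [integral_const_mul, integral_gaussian, show Real.pi / (1 / 2) = 2 * Real.pi by ring]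
  exact one_div_mul_cancel (by positivity)

lemma phi_le_exp (l z : ℝ) : phi z ≤ Real.exp (-l * z + l ^ 2 / 2) := by
  have h1 : 1 / Real.sqrt (2 * Real.pi) ≤ 1 := by
    rw [div_le_one (by positivity), Real.one_le_sqrt]
    linarith [Real.pi_gt_three]
  have h2 : -z ^ 2 / 2 ≤ -l * z + l ^ 2 / 2 := by nlinarith [sq_nonneg (z - l)]
  calc phi z ≤ 1 * Real.exp (-z ^ 2 / 2) := by
        unfold phi
        gcongr
    _ ≤ _ := by
        rw [one_mul]
        exact Real.exp_le_exp.2 h2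

lemma Psi_nonneg (z : ℝ) : 0 ≤ Psi z := integral_nonneg phi_nonneg

lemma Psi_le_exp {l : ℝ} (hl : 0 ≤ l) (z : ℝ) : Psi z ≤ Real.exp (-l * z + l ^ 2 / 2) := by
  have hi : Integrable fun y => Real.exp (-l * z + l ^ 2 / 2) * phi (y - l) :=
    (integrable_phi.comp_sub_right l).const_mul _
  calc Psi z ≤ ∫ y in Ioi z, Real.exp (-l * z + l ^ 2 / 2) * phi (y - l) := by
        refine setIntegral_mono_on integrable_phi.integrableOn hi.integrableOn measurableSet_Ioi ?_
        intro y hy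
        rw [sub_eq_add_neg y l, phi_add, mul_left_comm, ← Real.exp_add]
        refine le_mul_of_one_le_right (phi_nonneg y) (Real.one_le_exp ?_)
        nlinarith [mul_nonneg hl (sub_nonneg.2 (le_of_lt hy))]
    _ ≤ ∫ y, Real.exp (-l * z + l ^ 2 / 2) * phi (y - l) :=
        setIntegral_le_integral hi
          (Eventually.of_forall fun y => mul_nonneg (Real.exp_nonneg _) (phi_nonneg _))
    _ = _ := by
        rw [integral_const_mul, integral_sub_right_eq_self phi l, integral_phi, mul_one]

lemma hasDerivAt_Psi (z : ℝ) : HasDerivAt Psi (-phi z) z := by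
  have h : ∀ w, Psi w = Psi 0 - ∫ y in (0 : ℝ)..w, phi y := by
    intro w
    rw [← intervalIntegral.integral_Ioi_sub_Ioi' integrable_phi.integrableOn
      integrable_phi.integrableOn]
    simp [Psi]
  rw [funext h]
  exact (intervalIntegral.integral_hasDerivAt_right (continuous_phi.intervalIntegrable _ _)
    continuous_phi.stronglyMeasurable.stronglyMeasurableAtFilter
    continuous_phi.continuousAt).const_sub _

lemma continuous_Psi : Continuous Psi :=
  continuous_iff_continuousAt.2 fun z => (hasDerivAt_Psi z).continuousAt

lemma tendsto_Psi_atTop : Tendsto Psi atTop (nhds 0) := by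
  refine squeeze_zero Psi_nonneg (fun z => Psi_le_exp zero_le_one z) ?_
  refine Real.tendsto_exp_atBot.comp ?_
  simp only [neg_mul, one_mul]
  exact tendsto_atBot_add_const_right _ _ tendsto_neg_atTop_atBot

/-- The family `F i`, `i ∈ S`, decays on `(0, ∞)` faster than every exponential, uniformly. -/
def ExpDecay {ι : Type*} (S : Set ι) (F : ι → ℝ → ℝ) : Prop :=
  ∀ k : ℕ, ∃ C : ℝ, ∀ i ∈ S, ∀ y > (0 : ℝ), |F i y| ≤ C * Real.exp (-(k * y))

/-- The family `F i`, `i ∈ S`, grows on `(0, ∞)` at most exponentially, uniformly. -/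
def ExpGrowth {ι : Type*} (S : Set ι) (F : ι → ℝ → ℝ) : Prop :=
  ∃ m : ℕ, ∃ C : ℝ, ∀ i ∈ S, ∀ y > (0 : ℝ), |F i y| ≤ C * Real.exp (m * y)

section Families

variable {ι : Type*} {S : Set ι} {F G : ι → ℝ → ℝ}

lemma ExpDecay.congr (hF : ExpDecay S F) (h : ∀ i y, G i y = F i y) : ExpDecay S G := by
  rwa [show G = F from funext₂ h]

lemma ExpDecay.add (hF : ExpDecay S F) (hG : ExpDecay S G) :
    ExpDecay S fun i y => F i y + G i y := by
  intro k
  obtain ⟨C, hC⟩ := hF k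
  obtain ⟨D, hD⟩ := hG k
  refine ⟨C + D, fun i hi y hy => (abs_add_le _ _).trans ?_⟩
  rw [add_mul]
  exact add_le_add (hC i hi y hy) (hD i hi y hy)

lemma ExpGrowth.mul_decay (hG : ExpGrowth S G) (hF : ExpDecay S F) :
    ExpDecay S fun i y => G i y * F i y := by
  intro k
  obtain ⟨m, D, hD⟩ := hG
  obtain ⟨C, hC⟩ := hF (k + m)
  refine ⟨D * C, fun i hi y hy => ?_⟩
  rw [abs_mul]
  refine (mul_le_mul (hD i hi y hy) (hC i hi y hy) (abs_nonneg _)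
    ((abs_nonneg _).trans (hD i hi y hy))).trans_eq ?_
  rw [mul_mul_mul_comm, ← Real.exp_add]
  congr 2
  push_cast
  ring

lemma ExpGrowth.add (hF : ExpGrowth S F) (hG : ExpGrowth S G) :
    ExpGrowth S fun i y => F i y + G i y := by
  obtain ⟨m, C, hC⟩ := hF
  obtain ⟨n, D, hD⟩ := hG
  refine ⟨m + n, |C| + |D|, fun i hi y hy => (abs_add_le _ _).trans ?_⟩
  rw [add_mul]
  have hm : (0 : ℝ) ≤ m * y := by positivity
  have hn : (0 : ℝ) ≤ n * y := by positivity
  refine add_le_add ((hC i hi y hy).trans ?_) ((hD i hi y hy).trans ?_)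
  · gcongr
    · exact le_abs_self C
    · simp
  · gcongr
    · exact le_abs_self D
    · simp

lemma ExpGrowth.mul (hF : ExpGrowth S F) (hG : ExpGrowth S G) :
    ExpGrowth S fun i y => F i y * G i y := by
  obtain ⟨m, C, hC⟩ := hF
  obtain ⟨n, D, hD⟩ := hG
  refine ⟨m + n, C * D, fun i hi y hy => ?_⟩
  rw [abs_mul]
  refine (mul_le_mul (hC i hi y hy) (hD i hi y hy) (abs_nonneg _)
    ((abs_nonneg _).trans (hC i hi y hy))).trans_eq ?_
  rw [mul_mul_mul_comm, ← Real.exp_add]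
  congr 2
  push_cast
  ring

lemma ExpGrowth.of_bounded (C : ℝ) (h : ∀ i ∈ S, ∀ y > (0 : ℝ), |F i y| ≤ C) :
    ExpGrowth S F :=
  ⟨0, C, by simpa using h⟩

lemma ExpGrowth.const (c : ℝ) : ExpGrowth S fun _ _ => c :=
  .of_bounded |c| fun _ _ _ _ => le_rfl

lemma ExpGrowth.exp_linear {b : ι → ℝ} (a B : ℝ) (hb : ∀ i ∈ S, b i ≤ B) :
    ExpGrowth S fun i y => Real.exp (a * y + b i) := by
  refine ⟨⌈|a|⌉₊, Real.exp B, fun i hi y hy => ?_⟩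
  rw [Real.abs_exp, ← Real.exp_add]
  have h : a * y ≤ ⌈|a|⌉₊ * y :=
    mul_le_mul_of_nonneg_right ((le_abs_self a).trans (Nat.le_ceil _)) hy.le
  exact Real.exp_le_exp.2 (by linarith [hb i hi])

lemma ExpGrowth.id : ExpGrowth S fun _ y => y := by
  refine ⟨1, 1, fun i _ y hy => ?_⟩
  rw [abs_of_pos hy, one_mul, Nat.cast_one, one_mul]
  linarith [Real.add_one_le_exp y]

/-- Super-exponential decay passes from a function with Chernoff bounds to its rescalings. -/
lemma ExpDecay.of_chernoff {P : ℝ → ℝ}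
    (hP : ∀ l : ℝ, 0 ≤ l → ∀ z, |P z| ≤ Real.exp (-l * z + l ^ 2 / 2)) {t : ι → ℝ}
    {z : ι → ℝ → ℝ} (T R : ℝ) (ht : ∀ i ∈ S, 0 < t i ∧ t i ≤ T)
    (hz : ∀ i ∈ S, ∀ y > (0 : ℝ), y - R ≤ z i y * Real.sqrt (t i)) :
    ExpDecay S fun i y => P (z i y) := by
  intro k
  refine ⟨Real.exp (k * R + k ^ 2 * T / 2), fun i hi y hy => ?_⟩
  refine (hP (k * Real.sqrt (t i)) (by positivity) _).trans ?_
  rw [← Real.exp_add, mul_pow, Real.sq_sqrt (ht i hi).1.le]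
  have h1 := mul_le_mul_of_nonneg_left (hz i hi y hy) (Nat.cast_nonneg (α := ℝ) k)
  have h2 := mul_le_mul_of_nonneg_left (ht i hi).2 (sq_nonneg (k : ℝ))
  exact Real.exp_le_exp.2 (by linarith)

lemma ExpDecay.phi_comp {t : ι → ℝ} {z : ι → ℝ → ℝ} (T R : ℝ) (ht : ∀ i ∈ S, 0 < t i ∧ t i ≤ T)
    (hz : ∀ i ∈ S, ∀ y > (0 : ℝ), y - R ≤ z i y * Real.sqrt (t i)) :
    ExpDecay S fun i y => phi (z i y) :=
  .of_chernoff (fun l _ z => by rw [abs_of_nonneg (phi_nonneg z)]; exact phi_le_exp l z) T R ht hz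

lemma ExpDecay.Psi_comp {t : ι → ℝ} {z : ι → ℝ → ℝ} (T R : ℝ) (ht : ∀ i ∈ S, 0 < t i ∧ t i ≤ T)
    (hz : ∀ i ∈ S, ∀ y > (0 : ℝ), y - R ≤ z i y * Real.sqrt (t i)) :
    ExpDecay S fun i y => Psi (z i y) :=
  .of_chernoff (fun l hl z => by rw [abs_of_nonneg (Psi_nonneg z)]; exact Psi_le_exp hl z)
    T R ht hz

end Families

lemma integrableOn_exp_neg_id : IntegrableOn (fun y : ℝ => Real.exp (-y)) (Ioi 0) := by
  simpa using exp_neg_integrableOn_Ioi 0 one_pos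

/-- Differentiation under the integral for a kernel decaying with its derivative. -/
lemma hasDerivAt_integral_mul_kernel {g : ℝ → ℝ} {K K' : ℝ → ℝ → ℝ} {x₀ B : ℝ}
    (hg : ContinuousOn g (Ici 0)) (hgB : ∀ y ∈ Ici (0 : ℝ), |g y| ≤ B)
    (hK : ∀ x, Continuous (K x)) (hK' : Continuous (K' x₀))
    (hd : ∀ x y, HasDerivAt (fun z => K z y) (K' x y) x)
    (hKd : ExpDecay (Metric.ball x₀ 1) K) (hKd' : ExpDecay (Metric.ball x₀ 1) K') :
    IntegrableOn (fun y => g y * K' x₀ y) (Ioi 0) ∧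
      HasDerivAt (fun x => ∫ y in Ioi 0, g y * K x y) (∫ y in Ioi 0, g y * K' x₀ y) x₀ := by
  obtain ⟨C, hC⟩ := hKd 1
  obtain ⟨D, hD⟩ := hKd' 1
  have hB : 0 ≤ B := (abs_nonneg _).trans (hgB 0 self_mem_Ici)
  have hgm : AEStronglyMeasurable g (volume.restrict (Ioi 0)) :=
    (hg.mono Ioi_subset_Ici_self).aestronglyMeasurable measurableSet_Ioi
  have hb : ∀ c : ℝ, IntegrableOn (fun y : ℝ => B * (c * Real.exp (-y))) (Ioi 0) :=
    fun c => (integrableOn_exp_neg_id.const_mul c).const_mul B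
  have hbd : ∀ (c : ℝ) (J : ℝ → ℝ → ℝ),
      (∀ x ∈ Metric.ball x₀ 1, ∀ y > (0 : ℝ), |J x y| ≤ c * Real.exp (-((1 : ℕ) * y))) →
      ∀ᵐ y ∂volume.restrict (Ioi (0 : ℝ)), ∀ x ∈ Metric.ball x₀ 1,
        ‖g y * J x y‖ ≤ B * (c * Real.exp (-y)) := by
    intro c J hJ
    refine (ae_restrict_iff' measurableSet_Ioi).2 (Eventually.of_forall fun y hy x hx => ?_)
    rw [Real.norm_eq_abs, abs_mul]
    refine mul_le_mul (hgB y (mem_Ici.2 (le_of_lt hy))) ?_ (abs_nonneg _) hB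
    simpa using hJ x hx y hy
  refine hasDerivAt_integral_of_dominated_loc_of_deriv_le (Metric.ball_mem_nhds x₀ one_pos)
    (Eventually.of_forall fun x => hgm.mul (hK x).aestronglyMeasurable) ?_
    (hgm.mul hK'.aestronglyMeasurable) (hbd D K' hD) (hb D)
    (Eventually.of_forall fun y x _ => (hd x y).const_mul (g y))
  exact (hb C).mono' (hgm.mul (hK x₀).aestronglyMeasurable)
    ((hbd C K hC).mono fun y hy => hy x₀ (Metric.mem_ball_self one_pos))

lemma HasDerivAt.phi {u : ℝ → ℝ} {u' x : ℝ} (h : HasDerivAt u u' x) :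
    HasDerivAt (fun x => phi (u x)) (-(u x * phi (u x)) * u') x :=
  (hasDerivAt_phi (u x)).comp x h

lemma HasDerivAt.Psi {u : ℝ → ℝ} {u' x : ℝ} (h : HasDerivAt u u' x) :
    HasDerivAt (fun x => Psi (u x)) (-_root_.phi (u x) * u') x :=
  (hasDerivAt_Psi (u x)).comp x h

lemma Continuous.phi {u : ℝ → ℝ} (h : Continuous u) : Continuous fun x => phi (u x) :=
  continuous_phi.comp h

lemma Continuous.Psi {u : ℝ → ℝ} (h : Continuous u) : Continuous fun x => Psi (u x) :=
  continuous_Psi.comp h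

lemma phi_add_mul_div_sqrt {t : ℝ} (ht : 0 < t) (u m : ℝ) :
    phi ((u + m * t) / Real.sqrt t) =
      phi (u / Real.sqrt t) * Real.exp (-m * u - m ^ 2 * t / 2) := by
  have hs : Real.sqrt t ≠ 0 := (Real.sqrt_pos.2 ht).ne'
  have h : (u + m * t) / Real.sqrt t = u / Real.sqrt t + m * Real.sqrt t := by
    rw [add_div, mul_div_assoc, Real.div_sqrt]
  rw [h, phi_add, mul_pow, Real.sq_sqrt ht.le]
  congr 2
  field_simp

/-- The `x`-derivative of `Gker`. -/
noncomputable def GkerDx (μ t x y : ℝ) : ℝ :=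
  (-(Real.exp (2 * μ * y) * ((x + y + μ * t) * phi ((x + y + μ * t) / Real.sqrt t))) / t -
    (x - y + μ * t) * phi ((x - y + μ * t) / Real.sqrt t) / t +
    2 * μ * Real.exp (2 * μ * y) * phi ((x + y + μ * t) / Real.sqrt t)) / Real.sqrt t

/-- The `y`-primitive of `GkerDx` vanishing at `y = 0`. -/
noncomputable def GkerPrim (μ t x y : ℝ) : ℝ :=
  (Real.exp (2 * μ * y) * phi ((x + y + μ * t) / Real.sqrt t) -
    phi ((x - y + μ * t) / Real.sqrt t)) / Real.sqrt t

/-- The `x`-derivative of `Hker`. -/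
noncomputable def HkerDx (μ ν t x y : ℝ) : ℝ :=
  2 * Real.exp (2 * μ * y) *
    ((2 * ν - μ) * Real.exp (2 * (ν - μ) * (x + y + ν * t)) *
      Psi ((x + y + (2 * ν - μ) * t) / Real.sqrt t) -
      phi ((x + y + μ * t) / Real.sqrt t) / Real.sqrt t)

section Kernels

variable {t : ℝ}

lemma hasDerivAt_Gker (ht : 0 < t) (μ x y : ℝ) :
    HasDerivAt (fun z => Gker μ t z y) (GkerDx μ t x y) x := by
  have ha : HasDerivAt (fun z => (z + y + μ * t) / Real.sqrt t) (1 / Real.sqrt t) x :=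
    (((hasDerivAt_id x).add_const y).add_const (μ * t)).div_const _
  have hb : HasDerivAt (fun z => (z - y + μ * t) / Real.sqrt t) (1 / Real.sqrt t) x :=
    (((hasDerivAt_id x).sub_const y).add_const (μ * t)).div_const _
  refine ((((ha.phi.const_mul (Real.exp (2 * μ * y))).add hb.phi).const_mul
    (1 / Real.sqrt t)).sub (ha.Psi.const_mul (2 * μ * Real.exp (2 * μ * y)))).congr_deriv ?_
  unfold GkerDx
  obtain ⟨s, hs, rfl⟩ : ∃ s : ℝ, 0 < s ∧ t = s ^ 2 :=
    ⟨_, Real.sqrt_pos.2 ht, (Real.sq_sqrt ht.le).symm⟩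
  rw [Real.sqrt_sq hs.le]
  field_simp
  ring

lemma hasDerivAt_GkerPrim (ht : 0 < t) (μ x y : ℝ) :
    HasDerivAt (fun z => GkerPrim μ t x z) (GkerDx μ t x y) y := by
  have ha : HasDerivAt (fun z => (x + z + μ * t) / Real.sqrt t) (1 / Real.sqrt t) y :=
    (((hasDerivAt_id y).const_add x).add_const (μ * t)).div_const _
  have hb : HasDerivAt (fun z => (x - z + μ * t) / Real.sqrt t) (-1 / Real.sqrt t) y :=
    (((hasDerivAt_id y).const_sub x).add_const (μ * t)).div_const _
  have he : HasDerivAt (fun z => Real.exp (2 * μ * z)) (Real.exp (2 * μ * y) * (2 * μ * 1)) y :=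
    ((hasDerivAt_id y).const_mul (2 * μ)).exp
  refine (((he.mul ha.phi).sub hb.phi).div_const (Real.sqrt t)).congr_deriv ?_
  unfold GkerDx
  obtain ⟨s, hs, rfl⟩ : ∃ s : ℝ, 0 < s ∧ t = s ^ 2 :=
    ⟨_, Real.sqrt_pos.2 ht, (Real.sq_sqrt ht.le).symm⟩
  rw [Real.sqrt_sq hs.le]
  field_simp
  ring

lemma hasDerivAt_Hker (ht : 0 < t) (μ ν x y : ℝ) :
    HasDerivAt (fun z => Hker μ ν t z y) (HkerDx μ ν t x y) x := by
  have hl : ∀ c : ℝ, HasDerivAt (fun z => z + y + c) 1 x :=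
    fun c => ((hasDerivAt_id x).add_const y).add_const c
  have ha : ∀ c : ℝ, HasDerivAt (fun z => (z + y + c * t) / Real.sqrt t) (1 / Real.sqrt t) x :=
    fun c => (hl (c * t)).div_const _
  have hs : 0 < Real.sqrt t := Real.sqrt_pos.2 ht
  unfold HkerDx
  rcases eq_or_ne ν μ with rfl | h
  · simp only [Hker, if_true]
    refine ((((((hl (ν * t)).const_mul ν).const_add 1).mul (ha ν).Psi).sub
      ((ha ν).phi.const_mul (ν * Real.sqrt t))).const_mul (2 * Real.exp (2 * ν * y))).congr_deriv ?_
    rw [sub_self, mul_zero, zero_mul, Real.exp_zero, show 2 * ν - ν = ν by ring]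
    field_simp
    ring
  · have hne : ν - μ ≠ 0 := sub_ne_zero.2 h
    simp only [Hker, if_neg h]
    have he := ((hl (ν * t)).const_mul (2 * (ν - μ))).exp
    refine ((((he.const_mul (2 * ν - μ)).mul (ha (2 * ν - μ)).Psi).sub
      ((ha μ).Psi.const_mul μ)).const_mul (Real.exp (2 * μ * y) / (ν - μ))).congr_deriv ?_
    have hphi : phi ((x + y + (2 * ν - μ) * t) / Real.sqrt t) =
        phi ((x + y + μ * t) / Real.sqrt t) *
          (Real.exp (2 * (ν - μ) * (x + y + ν * t)))⁻¹ := by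
      rw [show x + y + (2 * ν - μ) * t = x + y + μ * t + 2 * (ν - μ) * t by ring,
        phi_add_mul_div_sqrt ht, ← Real.exp_neg]
      congr 2
      ring
    rw [hphi]
    have := Real.exp_ne_zero (2 * (ν - μ) * (x + y + ν * t))
    field_simp
    ring

lemma continuous_GkerDx (μ t x : ℝ) : Continuous (GkerDx μ t x) := by
  have ha : Continuous fun y => phi ((x + y + μ * t) / Real.sqrt t) :=
    Continuous.phi (by fun_prop)
  have hb : Continuous fun y => phi ((x - y + μ * t) / Real.sqrt t) :=
    Continuous.phi (by fun_prop)
  unfold GkerDx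
  fun_prop

lemma continuous_Gker (μ t x : ℝ) : Continuous (Gker μ t x) := by
  have ha : Continuous fun y => phi ((x + y + μ * t) / Real.sqrt t) :=
    Continuous.phi (by fun_prop)
  have hb : Continuous fun y => phi ((x - y + μ * t) / Real.sqrt t) :=
    Continuous.phi (by fun_prop)
  have hc : Continuous fun y => Psi ((x + y + μ * t) / Real.sqrt t) :=
    Continuous.Psi (by fun_prop)
  unfold Gker
  fun_prop

lemma continuous_GkerPrim (μ t x : ℝ) : Continuous (GkerPrim μ t x) := by
  have ha : Continuous fun y => phi ((x + y + μ * t) / Real.sqrt t) :=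
    Continuous.phi (by fun_prop)
  have hb : Continuous fun y => phi ((x - y + μ * t) / Real.sqrt t) :=
    Continuous.phi (by fun_prop)
  unfold GkerPrim
  fun_prop

lemma continuous_Hker (μ ν t x : ℝ) : Continuous (Hker μ ν t x) := by
  have ha : Continuous fun y => phi ((x + y + μ * t) / Real.sqrt t) :=
    Continuous.phi (by fun_prop)
  have hb : ∀ c : ℝ, Continuous fun y => Psi ((x + y + c * t) / Real.sqrt t) :=
    fun c => Continuous.Psi (by fun_prop)
  have hμ := hb μ
  have hν := hb (2 * ν - μ)
  unfold Hker
  split_ifs <;> fun_prop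

lemma continuous_HkerDx (μ ν t x : ℝ) : Continuous (HkerDx μ ν t x) := by
  have ha : Continuous fun y => phi ((x + y + μ * t) / Real.sqrt t) :=
    Continuous.phi (by fun_prop)
  have hν : Continuous fun y => Psi ((x + y + (2 * ν - μ) * t) / Real.sqrt t) :=
    Continuous.Psi (by fun_prop)
  unfold HkerDx
  fun_prop

lemma abs_le_of_mem_ball {x x₀ : ℝ} (hx : x ∈ Metric.ball x₀ 1) : |x| ≤ |x₀| + 1 := by
  rw [Metric.mem_ball, Real.dist_eq] at hx
  have := abs_add_le (x - x₀) x₀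
  rw [sub_add_cancel] at this
  linarith

lemma phi_decay_add (ht : 0 < t) (c x₀ : ℝ) :
    ExpDecay (Metric.ball x₀ 1) fun x y => phi ((x + y + c * t) / Real.sqrt t) := by
  refine .phi_comp (t := fun _ => t) t (|x₀| + 1 + |c * t|) (fun _ _ => ⟨ht, le_rfl⟩) ?_
  intro x hx y _
  rw [div_mul_cancel₀ _ (Real.sqrt_pos.2 ht).ne']
  linarith [abs_le.1 (abs_le_of_mem_ball hx), neg_abs_le (c * t)]

lemma Psi_decay_add (ht : 0 < t) (c x₀ : ℝ) :
    ExpDecay (Metric.ball x₀ 1) fun x y => Psi ((x + y + c * t) / Real.sqrt t) := by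
  refine .Psi_comp (t := fun _ => t) t (|x₀| + 1 + |c * t|) (fun _ _ => ⟨ht, le_rfl⟩) ?_
  intro x hx y _
  rw [div_mul_cancel₀ _ (Real.sqrt_pos.2 ht).ne']
  linarith [abs_le.1 (abs_le_of_mem_ball hx), neg_abs_le (c * t)]

lemma phi_decay_sub (ht : 0 < t) (c x₀ : ℝ) :
    ExpDecay (Metric.ball x₀ 1) fun x y => phi ((x - y + c * t) / Real.sqrt t) := by
  suffices h : ExpDecay (Metric.ball x₀ 1) fun x y => phi ((y - x - c * t) / Real.sqrt t) by
    refine h.congr fun x y => ?_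
    rw [← phi_neg, ← neg_div]
    congr 2
    ring
  refine .phi_comp (t := fun _ => t) t (|x₀| + 1 + |c * t|) (fun _ _ => ⟨ht, le_rfl⟩) ?_
  intro x hx y _
  rw [div_mul_cancel₀ _ (Real.sqrt_pos.2 ht).ne']
  linarith [abs_le.1 (abs_le_of_mem_ball hx), le_abs_self (c * t)]

lemma growth_linear (x₀ a b c : ℝ) :
    ExpGrowth (Metric.ball x₀ 1) fun x y => a * x + b * y + c :=
  (((ExpGrowth.const a).mul (.of_bounded (|x₀| + 1) fun _ hx _ _ => abs_le_of_mem_ball hx)).add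
    ((ExpGrowth.const b).mul .id)).add (.const c)

lemma growth_exp_linear (x₀ a b c : ℝ) :
    ExpGrowth (Metric.ball x₀ 1) fun x y => Real.exp (b * y + (a * x + c)) := by
  refine .exp_linear (b := fun x => a * x + c) b (|a| * (|x₀| + 1) + c) fun x hx => ?_
  have h1 := (le_abs_self (a * x)).trans_eq (abs_mul a x)
  have h2 := mul_le_mul_of_nonneg_left (abs_le_of_mem_ball hx) (abs_nonneg a)
  linarith

lemma decay_GkerDx (ht : 0 < t) (μ x₀ : ℝ) : ExpDecay (Metric.ball x₀ 1) (GkerDx μ t) := by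
  have ha := phi_decay_add ht μ x₀
  have hb := phi_decay_sub ht μ x₀
  have he := growth_exp_linear x₀ 0 (2 * μ) 0
  have h := ((((he.mul (growth_linear x₀ (-1) (-1) (-(μ * t)))).mul
    (.const (1 / (t * Real.sqrt t)))).add (he.mul (.const (2 * μ / Real.sqrt t)))).mul_decay
    ha).add (((growth_linear x₀ (-1) 1 (-(μ * t))).mul
      (.const (1 / (t * Real.sqrt t)))).mul_decay hb)
  refine h.congr fun x y => ?_
  have := Real.sqrt_pos.2 ht
  simp only [zero_mul, add_zero]
  unfold GkerDx
  field_simp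
  ring

lemma decay_GkerPrim (ht : 0 < t) (μ x₀ : ℝ) : ExpDecay (Metric.ball x₀ 1) (GkerPrim μ t) := by
  have ha := phi_decay_add ht μ x₀
  have hb := phi_decay_sub ht μ x₀
  have he := growth_exp_linear x₀ 0 (2 * μ) 0
  have h := ((he.mul (.const (1 / Real.sqrt t))).mul_decay ha).add
    ((ExpGrowth.const (-(1 / Real.sqrt t))).mul_decay hb)
  refine h.congr fun x y => ?_
  simp only [zero_mul, add_zero]
  unfold GkerPrim
  ring

lemma decay_Gker (ht : 0 < t) (μ x₀ : ℝ) : ExpDecay (Metric.ball x₀ 1) (Gker μ t) := by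
  have ha := phi_decay_add ht μ x₀
  have hb := phi_decay_sub ht μ x₀
  have he := growth_exp_linear x₀ 0 (2 * μ) 0
  have h := (((he.mul (.const (1 / Real.sqrt t))).mul_decay ha).add
    ((ExpGrowth.const (1 / Real.sqrt t)).mul_decay hb)).add
    ((he.mul (.const (-2 * μ))).mul_decay (Psi_decay_add ht μ x₀))
  refine h.congr fun x y => ?_
  simp only [zero_mul, add_zero]
  unfold Gker
  ring

lemma decay_Hker (ht : 0 < t) (μ ν x₀ : ℝ) : ExpDecay (Metric.ball x₀ 1) (Hker μ ν t) := by
  have he := growth_exp_linear x₀ 0 (2 * μ) 0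
  have hμ := Psi_decay_add ht μ x₀
  by_cases hνμ : ν = μ
  · have h := (((he.mul (.const 2)).mul (growth_linear x₀ μ μ (1 + μ * (μ * t)))).mul_decay hμ).add
      ((he.mul (.const (-2 * μ * Real.sqrt t))).mul_decay (phi_decay_add ht μ x₀))
    refine h.congr fun x y => ?_
    simp only [zero_mul, add_zero, Hker, if_pos hνμ]
    ring
  · have h := (((he.mul (.const ((2 * ν - μ) / (ν - μ)))).mul
      (growth_exp_linear x₀ (2 * (ν - μ)) (2 * (ν - μ)) (2 * (ν - μ) * (ν * t)))).mul_decay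
      (Psi_decay_add ht (2 * ν - μ) x₀)).add
      ((he.mul (.const (-μ / (ν - μ)))).mul_decay hμ)
    refine h.congr fun x y => ?_
    simp only [zero_mul, add_zero, Hker, if_neg hνμ]
    rw [show 2 * (ν - μ) * (x + y + ν * t) =
      2 * (ν - μ) * y + (2 * (ν - μ) * x + 2 * (ν - μ) * (ν * t)) by ring]
    ring

lemma decay_HkerDx (ht : 0 < t) (μ ν x₀ : ℝ) : ExpDecay (Metric.ball x₀ 1) (HkerDx μ ν t) := by
  have he := growth_exp_linear x₀ 0 (2 * μ) 0
  have h := (((he.mul (.const (2 * (2 * ν - μ)))).mul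
      (growth_exp_linear x₀ (2 * (ν - μ)) (2 * (ν - μ)) (2 * (ν - μ) * (ν * t)))).mul_decay
      (Psi_decay_add ht (2 * ν - μ) x₀)).add
      ((he.mul (.const (-2 / Real.sqrt t))).mul_decay (phi_decay_add ht μ x₀))
  refine h.congr fun x y => ?_
  simp only [zero_mul, add_zero]
  unfold HkerDx
  rw [show 2 * (ν - μ) * (x + y + ν * t) =
    2 * (ν - μ) * y + (2 * (ν - μ) * x + 2 * (ν - μ) * (ν * t)) by ring]
  ring

end Kernels

lemma ExpDecay.integrableOn_mul {g J : ℝ → ℝ} {B : ℝ} (hg : ContinuousOn g (Ici 0))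
    (hgB : ∀ y ∈ Ici (0 : ℝ), |g y| ≤ B) (hJ : Continuous J)
    (hJd : ExpDecay (univ : Set Unit) fun _ => J) :
    IntegrableOn (fun y => g y * J y) (Ioi 0) := by
  obtain ⟨C, hC⟩ := hJd 1
  have hB : 0 ≤ B := (abs_nonneg _).trans (hgB 0 self_mem_Ici)
  refine ((integrableOn_exp_neg_id.const_mul C).const_mul B).mono'
    (((hg.mono Ioi_subset_Ici_self).aestronglyMeasurable measurableSet_Ioi).mul
      hJ.aestronglyMeasurable) ?_
  refine (ae_restrict_iff' measurableSet_Ioi).2 (Eventually.of_forall fun y hy => ?_)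
  rw [Real.norm_eq_abs, abs_mul]
  refine mul_le_mul (hgB y (mem_Ici.2 (le_of_lt hy))) ?_ (abs_nonneg _) hB
  simpa using hC () trivial y hy

lemma ExpDecay.tendsto_mul {g J : ℝ → ℝ} {B : ℝ} (hgB : ∀ y ∈ Ici (0 : ℝ), |g y| ≤ B)
    (hJd : ExpDecay (univ : Set Unit) fun _ => J) :
    Tendsto (fun y => g y * J y) atTop (nhds 0) := by
  obtain ⟨C, hC⟩ := hJd 1
  have hB : 0 ≤ B := (abs_nonneg _).trans (hgB 0 self_mem_Ici)
  refine squeeze_zero_norm' (a := fun y => B * (C * Real.exp (-y))) ?_ ?_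
  · filter_upwards [eventually_gt_atTop 0] with y hy
    rw [Real.norm_eq_abs, abs_mul]
    refine mul_le_mul (hgB y (mem_Ici.2 (le_of_lt hy))) ?_ (abs_nonneg _) hB
    simpa using hC () trivial y hy
  · simpa using (Real.tendsto_exp_neg_atTop_nhds_zero.const_mul C).const_mul B

/-- Restriction of a uniform decay estimate to one member of the family. -/
lemma ExpDecay.single {ι : Type*} {S : Set ι} {F : ι → ℝ → ℝ} (hF : ExpDecay S F) {i : ι}
    (hi : i ∈ S) : ExpDecay (univ : Set Unit) fun _ => F i := by
  intro k
  obtain ⟨C, hC⟩ := hF k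
  exact ⟨C, fun _ _ => hC i hi⟩

lemma HasDerivAt.derivWithin_Ici {F : ℝ → ℝ} {F' x : ℝ} (h : HasDerivAt F F' x) (hx : 0 ≤ x) :
    derivWithin F (Ici 0) x = F' :=
  h.hasDerivWithinAt.derivWithin (uniqueDiffOn_Ici 0 x hx)

lemma derivWithin_integral_mul_Gker {f : ℝ → ℝ} (hf : IsInitialData f) (μ : ℝ) {t x : ℝ}
    (ht : 0 < t) (hx : 0 ≤ x) :
    derivWithin (fun x' => ∫ y in Ioi (0 : ℝ), f y * Gker μ t x' y) (Ici 0) x =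
      -∫ y in Ioi (0 : ℝ), derivWithin f (Ici 0) y * GkerPrim μ t x y := by
  obtain ⟨hf1, ⟨C, hC⟩, -⟩ := hf
  have hmem : x ∈ Metric.ball x 1 := Metric.mem_ball_self one_pos
  have hPd := (decay_GkerPrim ht μ x).single hmem
  obtain ⟨hint, hderiv⟩ := hasDerivAt_integral_mul_kernel (x₀ := x) hf1.continuousOn
    (fun y hy => (hC y hy).1) (continuous_Gker μ t) (continuous_GkerDx μ t x)
    (hasDerivAt_Gker ht μ) (decay_Gker ht μ x) (decay_GkerDx ht μ x)
  rw [hderiv.derivWithin_Ici hx]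
  have hfd : ∀ y ∈ Ioi (0 : ℝ), HasDerivAt f (derivWithin f (Ici 0) y) y := fun y hy =>
    ((hf1.differentiableOn one_ne_zero) y (mem_Ici.2 (le_of_lt hy))).hasDerivWithinAt.hasDerivAt
      (Ici_mem_nhds hy)
  have hzero : Tendsto (f * GkerPrim μ t x) (nhdsWithin 0 (Ioi 0)) (nhds 0) := by
    have h0 : f 0 * GkerPrim μ t x 0 = 0 := by simp [GkerPrim]
    have := ((hf1.continuousOn 0 self_mem_Ici).mono_left
      (nhdsWithin_mono _ Ioi_subset_Ici_self)).mul
      ((continuous_GkerPrim μ t x).continuousWithinAt (s := Ioi 0) (x := 0))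
    rwa [h0] at this
  rw [integral_Ioi_mul_deriv_eq_deriv_mul hfd (fun y _ => hasDerivAt_GkerPrim ht μ x y) hint
    (ExpDecay.integrableOn_mul (hf1.continuousOn_derivWithin (uniqueDiffOn_Ici 0) le_rfl)
      (fun y hy => (hC y hy).2) (continuous_GkerPrim μ t x) hPd) hzero
    (ExpDecay.tendsto_mul (fun y hy => (hC y hy).1) hPd), sub_zero, zero_sub]

/-- Folding a Gaussian average of `q ∘ |·|` onto the half-line. -/
lemma integral_Ioi_mul_phi_add_phi {q : ℝ → ℝ} {s : ℝ} (hs : 0 < s) (x : ℝ)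
    (hq : Integrable fun z => q |x + s * z| * phi z) :
    ∫ y in Ioi 0, q y * ((phi ((x - y) / s) + phi ((x + y) / s)) / s) =
      ∫ z, q |x + s * z| * phi z := by
  have hQ : ∀ y, q |x + s * ((y - x) / s)| * phi ((y - x) / s) = q |y| * phi ((x - y) / s) := by
    intro y
    rw [mul_div_cancel₀ _ hs.ne', add_sub_cancel, ← phi_neg, ← neg_div, neg_sub]
  have hI : Integrable fun y => q |y| * phi ((x - y) / s) := by
    simpa only [hQ] using (hq.comp_div hs.ne').comp_sub_right x
  have hneg : ∫ y in Iic 0, q |y| * phi ((x - y) / s) =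
      ∫ y in Ioi 0, q y * phi ((x + y) / s) := by
    rw [← neg_zero, ← integral_comp_neg_Ioi, neg_zero]
    refine setIntegral_congr_fun measurableSet_Ioi fun y hy => ?_
    simp only [abs_neg, abs_of_pos (mem_Ioi.1 hy), sub_neg_eq_add]
  have hpos : ∫ y in Ioi 0, q |y| * phi ((x - y) / s) =
      ∫ y in Ioi 0, q y * phi ((x - y) / s) :=
    setIntegral_congr_fun measurableSet_Ioi fun y hy => by simp only [abs_of_pos (mem_Ioi.1 hy)]
  have hIpos : IntegrableOn (fun y => q y * phi ((x - y) / s)) (Ioi 0) :=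
    (hI.integrableOn (s := Ioi 0)).congr_fun
      (fun y hy => by simp only [abs_of_pos (mem_Ioi.1 hy)]) measurableSet_Ioi
  have hIneg : IntegrableOn (fun y => q y * phi ((x + y) / s)) (Ioi 0) :=
    (hI.comp_neg.integrableOn (s := Ioi 0)).congr_fun
      (fun y hy => by simp only [abs_neg, abs_of_pos (mem_Ioi.1 hy), sub_neg_eq_add])
      measurableSet_Ioi
  have key : ∫ y, q |y| * phi ((x - y) / s) = s * ∫ z, q |x + s * z| * phi z := by
    have h := integral_sub_right_eq_self (μ := volume)
      (fun y => q |x + s * (y / s)| * phi (y / s)) x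
    simp only [hQ] at h
    rw [h, Measure.integral_comp_div (fun z => q |x + s * z| * phi z), smul_eq_mul,
      abs_of_pos hs]
  rw [← intervalIntegral.integral_Iic_add_Ioi (b := 0) hI.integrableOn hI.integrableOn, hneg, hpos,
    add_comm, ← integral_add hIpos hIneg] at key
  have hfun : ∀ y, q y * ((phi ((x - y) / s) + phi ((x + y) / s)) / s) =
      (q y * phi ((x - y) / s) + q y * phi ((x + y) / s)) / s := fun y => by ring
  simp_rw [hfun]
  rw [integral_div, key, mul_div_cancel_left₀ _ hs.ne']

lemma integrable_exp_mul_abs_mul_phi (m : ℝ) :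
    Integrable fun z => Real.exp (m * |z|) * phi z := by
  have h := ((integrable_phi.comp_add_right m).add (integrable_phi.comp_add_right (-m))).const_mul
    (Real.exp (m ^ 2 / 2))
  refine h.mono' (Continuous.aestronglyMeasurable ?_) (Eventually.of_forall fun z => ?_)
  · have := continuous_phi
    fun_prop
  · rw [Real.norm_of_nonneg (mul_nonneg (Real.exp_nonneg _) (phi_nonneg z))]
    have e : ∀ l : ℝ, Real.exp (m ^ 2 / 2) * (phi z * Real.exp (-l * z - l ^ 2 / 2)) =
        phi z * Real.exp (m ^ 2 / 2 - l ^ 2 / 2 - l * z) := by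
      intro l
      rw [mul_left_comm, ← Real.exp_add]
      congr 2
      ring
    simp only [Pi.add_apply]
    rw [phi_add, phi_add, mul_add, e, e, mul_comm]
    rcases abs_cases z with ⟨hz, -⟩ | ⟨hz, -⟩
    · rw [hz, show m ^ 2 / 2 - (-m) ^ 2 / 2 - -m * z = m * z by ring]
      exact le_add_of_nonneg_left (mul_nonneg (phi_nonneg z) (Real.exp_nonneg _))
    · rw [hz, show m ^ 2 / 2 - m ^ 2 / 2 - m * z = m * -z by ring]
      exact le_add_of_nonneg_right (mul_nonneg (phi_nonneg z) (Real.exp_nonneg _))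

section Limits

variable {g : ℝ → ℝ} {B : ℝ}

lemma continuous_comp_abs (hg : ContinuousOn g (Ici 0)) : Continuous fun y => g |y| :=
  hg.comp_continuous continuous_abs fun y => abs_nonneg y

lemma gaussian_average_bound (hgB : ∀ y ∈ Ici (0 : ℝ), |g y| ≤ B) (μ : ℝ) {x s R : ℝ}
    (hx : |x| ≤ R) (hs : |s| ≤ R) (z : ℝ) :
    ‖g |x + s * z| * Real.exp (μ * |x + s * z|) * phi z‖ ≤
      B * Real.exp (|μ| * R) * (Real.exp (|μ| * R * |z|) * phi z) := by
  have hB : 0 ≤ B := (abs_nonneg _).trans (hgB 0 self_mem_Ici)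
  have h1 : |x + s * z| ≤ R + R * |z| :=
    (abs_add_le _ _).trans (add_le_add hx (by rw [abs_mul]; gcongr))
  have h2 : Real.exp (μ * |x + s * z|) ≤ Real.exp (|μ| * R) * Real.exp (|μ| * R * |z|) := by
    rw [← Real.exp_add]
    refine Real.exp_le_exp.2 ?_
    calc μ * |x + s * z| ≤ |μ| * (R + R * |z|) :=
          mul_le_mul (le_abs_self μ) h1 (abs_nonneg _) (abs_nonneg _)
      _ = |μ| * R + |μ| * R * |z| := by ring
  rw [Real.norm_eq_abs, abs_mul, abs_mul, Real.abs_exp, abs_of_nonneg (phi_nonneg z)]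
  calc |(g |x + s * z|)| * Real.exp (μ * |x + s * z|) * phi z
      ≤ B * (Real.exp (|μ| * R) * Real.exp (|μ| * R * |z|)) * phi z :=
        mul_le_mul_of_nonneg_right
          (mul_le_mul (hgB _ (mem_Ici.2 (abs_nonneg _))) h2 (Real.exp_nonneg _) hB) (phi_nonneg z)
    _ = _ := by ring

lemma continuous_gaussian_average_integrand (hg : ContinuousOn g (Ici 0)) (μ x s : ℝ) :
    Continuous fun z => g |x + s * z| * Real.exp (μ * |x + s * z|) * phi z := by
  have h1 : Continuous fun z => g |x + s * z| :=
    (continuous_comp_abs hg).comp (by fun_prop : Continuous fun z => x + s * z)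
  exact (h1.mul (by fun_prop)).mul continuous_phi

lemma integrable_gaussian_average (hg : ContinuousOn g (Ici 0))
    (hgB : ∀ y ∈ Ici (0 : ℝ), |g y| ≤ B) (μ x s : ℝ) :
    Integrable fun z => g |x + s * z| * Real.exp (μ * |x + s * z|) * phi z :=
  ((integrable_exp_mul_abs_mul_phi _).const_mul _).mono'
    (continuous_gaussian_average_integrand hg μ x s).aestronglyMeasurable
    (Eventually.of_forall
      (gaussian_average_bound hgB μ (le_max_left |x| |s|) (le_max_right |x| |s|)))

lemma eventually_near_origin :
    ∀ᶠ p : ℝ × ℝ in nhdsWithin (0, 0) (Ioi 0 ×ˢ Ici 0), (0 < p.1 ∧ p.1 ≤ 1) ∧ |p.2| ≤ 1 := by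
  have h1 : ∀ᶠ p : ℝ × ℝ in nhds (0, 0), p.1 ≤ 1 :=
    (continuous_fst.tendsto (0, 0)).eventually (eventually_le_nhds one_pos)
  have h2 : ∀ᶠ p : ℝ × ℝ in nhds (0, 0), |p.2| ≤ 1 :=
    (continuous_snd.abs.tendsto (0, 0)).eventually (eventually_le_nhds (by simp))
  filter_upwards [nhdsWithin_le_nhds h1, nhdsWithin_le_nhds h2, self_mem_nhdsWithin]
    with p h1 h2 h3 using ⟨⟨h3.1, h1⟩, h2⟩

lemma tendsto_gaussian_average (hg : ContinuousOn g (Ici 0))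
    (hgB : ∀ y ∈ Ici (0 : ℝ), |g y| ≤ B) (μ : ℝ) :
    Tendsto (fun p : ℝ × ℝ => ∫ z, g |p.2 + Real.sqrt p.1 * z| *
        Real.exp (μ * |p.2 + Real.sqrt p.1 * z|) * phi z)
      (nhdsWithin (0, 0) (Ioi 0 ×ˢ Ici 0)) (nhds (g 0)) := by
  have hlim : g 0 = ∫ z, g 0 * phi z := by rw [integral_const_mul, integral_phi, mul_one]
  rw [hlim]
  refine tendsto_integral_filter_of_dominated_convergence
    (fun z => B * Real.exp (|μ| * 1) * (Real.exp (|μ| * 1 * |z|) * phi z))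
    (Eventually.of_forall fun p =>
      (continuous_gaussian_average_integrand hg μ _ _).aestronglyMeasurable) ?_
    ((integrable_exp_mul_abs_mul_phi _).const_mul _) (Eventually.of_forall fun z => ?_)
  · filter_upwards [eventually_near_origin] with p hp
    refine Eventually.of_forall (gaussian_average_bound hgB μ hp.2 ?_)
    rw [abs_of_nonneg (Real.sqrt_nonneg _)]
    exact Real.sqrt_le_one.2 hp.1.2
  · have hc : Continuous fun p : ℝ × ℝ => p.2 + Real.sqrt p.1 * z := by fun_prop
    have h1 : Continuous fun p : ℝ × ℝ => g |p.2 + Real.sqrt p.1 * z| :=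
      (continuous_comp_abs hg).comp hc
    have h2 : Continuous fun p : ℝ × ℝ => g |p.2 + Real.sqrt p.1 * z| *
        Real.exp (μ * |p.2 + Real.sqrt p.1 * z|) * phi z :=
      (h1.mul (by fun_prop)).mul continuous_const
    have := h2.tendsto (0, 0)
    simp only [Real.sqrt_zero, zero_mul, add_zero, abs_zero, mul_zero, Real.exp_zero,
      mul_one] at this
    exact this.mono_left nhdsWithin_le_nhds

/-- The part of `HkerDx` involving the normal tail. -/
noncomputable def tailKer (μ ν t x y : ℝ) : ℝ :=
  Real.exp (2 * ν * y + 2 * (ν - μ) * (x + ν * t)) *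
    Psi ((x + y + (2 * ν - μ) * t) / Real.sqrt t)

lemma continuous_tailKer (μ ν t x : ℝ) : Continuous (tailKer μ ν t x) := by
  have h : Continuous fun y => Psi ((x + y + (2 * ν - μ) * t) / Real.sqrt t) :=
    Continuous.Psi (by fun_prop)
  unfold tailKer
  fun_prop

lemma decay_tailKer (μ ν : ℝ) {T R : ℝ} :
    ExpDecay {p : ℝ × ℝ | (0 < p.1 ∧ p.1 ≤ T) ∧ |p.2| ≤ R}
      fun p : ℝ × ℝ => tailKer μ ν p.1 p.2 := by
  have hc : ∀ (c : ℝ) (p : ℝ × ℝ), 0 < p.1 ∧ p.1 ≤ T → |c * p.1| ≤ |c| * T := by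
    intro c p hp
    rw [abs_mul, abs_of_pos hp.1]
    exact mul_le_mul_of_nonneg_left hp.2 (abs_nonneg c)
  refine ExpGrowth.mul_decay
    (ExpGrowth.exp_linear (b := fun p : ℝ × ℝ => 2 * (ν - μ) * (p.2 + ν * p.1)) (2 * ν)
      (|2 * (ν - μ)| * (R + |ν| * T)) ?_)
    (.Psi_comp (t := fun p : ℝ × ℝ => p.1) T (R + |2 * ν - μ| * T) (fun _ hp => hp.1) ?_)
  · rintro p ⟨hp1, hp2⟩
    refine (le_abs_self _).trans ?_
    rw [abs_mul]
    gcongr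
    exact (abs_add_le _ _).trans (add_le_add hp2 (hc ν p hp1))
  · rintro p ⟨hp1, hp2⟩ y _
    rw [div_mul_cancel₀ _ (Real.sqrt_pos.2 hp1.1).ne']
    linarith [abs_le.1 hp2, abs_le.1 (hc (2 * ν - μ) p hp1)]

lemma tendsto_integral_tailKer (hg : ContinuousOn g (Ici 0))
    (hgB : ∀ y ∈ Ici (0 : ℝ), |g y| ≤ B) (μ ν : ℝ) :
    Tendsto (fun p : ℝ × ℝ => ∫ y in Ioi 0, g y * tailKer μ ν p.1 p.2 y)
      (nhdsWithin (0, 0) (Ioi 0 ×ˢ Ici 0)) (nhds 0) := by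
  obtain ⟨C, hC⟩ := decay_tailKer μ ν (T := 1) (R := 1) 1
  have hB : 0 ≤ B := (abs_nonneg _).trans (hgB 0 self_mem_Ici)
  rw [show nhds (0 : ℝ) = nhds (∫ _ in Ioi (0 : ℝ), (0 : ℝ)) by simp]
  refine tendsto_integral_filter_of_dominated_convergence (fun y => B * (C * Real.exp (-y)))
    (Eventually.of_forall fun p : ℝ × ℝ =>
      ((hg.mono Ioi_subset_Ici_self).aestronglyMeasurable measurableSet_Ioi).mul
        (continuous_tailKer μ ν p.1 p.2).aestronglyMeasurable) ?_
    ((integrableOn_exp_neg_id.const_mul C).const_mul B) ?_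
  · filter_upwards [eventually_near_origin] with p hp
    refine (ae_restrict_iff' measurableSet_Ioi).2 (Eventually.of_forall fun y hy => ?_)
    rw [Real.norm_eq_abs, abs_mul]
    refine mul_le_mul (hgB y (mem_Ici.2 (le_of_lt hy))) ?_ (abs_nonneg _) hB
    simpa using hC p hp y hy
  · refine (ae_restrict_iff' measurableSet_Ioi).2 (Eventually.of_forall fun y hy => ?_)
    have hexp : Tendsto
        (fun p : ℝ × ℝ => Real.exp (2 * ν * y + 2 * (ν - μ) * (p.2 + ν * p.1)))
        (nhdsWithin (0, 0) (Ioi 0 ×ˢ Ici 0))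
        (nhds (Real.exp (2 * ν * y + 2 * (ν - μ) * (0 + ν * 0)))) :=
      ((by fun_prop : Continuous fun p : ℝ × ℝ =>
        Real.exp (2 * ν * y + 2 * (ν - μ) * (p.2 + ν * p.1))).tendsto (0, 0)).mono_left
          nhdsWithin_le_nhds
    have hnum : Tendsto (fun p : ℝ × ℝ => p.2 + y + (2 * ν - μ) * p.1)
        (nhdsWithin (0, 0) (Ioi 0 ×ˢ Ici 0)) (nhds (0 + y + (2 * ν - μ) * 0)) :=
      ((by fun_prop : Continuous fun p : ℝ × ℝ =>
        p.2 + y + (2 * ν - μ) * p.1).tendsto (0, 0)).mono_left nhdsWithin_le_nhds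
    have hsqrt : Tendsto (fun p : ℝ × ℝ => Real.sqrt p.1)
        (nhdsWithin (0, 0) (Ioi 0 ×ˢ Ici 0)) (nhdsWithin 0 (Ioi 0)) := by
      refine tendsto_nhdsWithin_iff.2 ⟨?_, ?_⟩
      · have := (by fun_prop : Continuous fun p : ℝ × ℝ => Real.sqrt p.1).tendsto (0, 0)
        simp only [Real.sqrt_zero] at this
        exact this.mono_left nhdsWithin_le_nhds
      · filter_upwards [self_mem_nhdsWithin] with p hp using Real.sqrt_pos.2 hp.1
    have hnum_pos : 0 < 0 + y + (2 * ν - μ) * 0 := by simpa using hy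
    have harg := hnum.pos_mul_atTop hnum_pos (tendsto_inv_nhdsGT_zero.comp hsqrt)
    simpa [tailKer, div_eq_mul_inv] using
      ((hexp.mul (tendsto_Psi_atTop.comp harg)).const_mul (g y))

end Limits

lemma neg_GkerPrim_sub_HkerDx {t : ℝ} (ht : 0 < t) (μ ν x y : ℝ) :
    -GkerPrim μ t x y - HkerDx μ ν t x y =
      Real.exp (-μ * x - μ ^ 2 * t / 2) * (Real.exp (μ * y) *
        ((phi ((x - y) / Real.sqrt t) + phi ((x + y) / Real.sqrt t)) / Real.sqrt t)) -
      2 * (2 * ν - μ) * tailKer μ ν t x y := by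
  have hb : Real.exp (-μ * (x - y) - μ ^ 2 * t / 2) =
      Real.exp (-μ * x - μ ^ 2 * t / 2) * Real.exp (μ * y) := by
    rw [← Real.exp_add]
    congr 1
    ring
  have ha : Real.exp (2 * μ * y) * Real.exp (-μ * (x + y) - μ ^ 2 * t / 2) =
      Real.exp (-μ * x - μ ^ 2 * t / 2) * Real.exp (μ * y) := by
    rw [← Real.exp_add, ← Real.exp_add]
    congr 1
    ring
  have hc : Real.exp (2 * ν * y + 2 * (ν - μ) * (x + ν * t)) =
      Real.exp (2 * μ * y) * Real.exp (2 * (ν - μ) * (x + y + ν * t)) := by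
    rw [← Real.exp_add]
    congr 1
    ring
  unfold GkerPrim HkerDx tailKer
  rw [phi_add_mul_div_sqrt ht, phi_add_mul_div_sqrt ht, hb, hc]
  linear_combination (phi ((x + y) / Real.sqrt t) / Real.sqrt t) * ha

lemma derivWithin_sub_derivWithin_eq (μ ν : ℝ) {f : ℝ → ℝ} (hf : IsInitialData f) {t x : ℝ}
    (ht : 0 < t) (hx : 0 ≤ x) :
    derivWithin (fun x' => ∫ y in Ioi (0 : ℝ), f y * Gker μ t x' y) (Ici 0) x -
        derivWithin (fun x' => ∫ y in Ioi (0 : ℝ),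
          derivWithin f (Ici 0) y * Hker μ ν t x' y) (Ici 0) x =
      Real.exp (-μ * x - μ ^ 2 * t / 2) *
          (∫ z, derivWithin f (Ici 0) |x + Real.sqrt t * z| *
            Real.exp (μ * |x + Real.sqrt t * z|) * phi z) -
        2 * (2 * ν - μ) * ∫ y in Ioi 0, derivWithin f (Ici 0) y * tailKer μ ν t x y := by
  rw [derivWithin_integral_mul_Gker hf μ ht hx]
  obtain ⟨hf1, ⟨C, hC⟩, -⟩ := hf
  have hg : ContinuousOn (derivWithin f (Ici 0)) (Ici 0) :=
    hf1.continuousOn_derivWithin (uniqueDiffOn_Ici 0) le_rfl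
  have hgB : ∀ y ∈ Ici (0 : ℝ), |derivWithin f (Ici 0) y| ≤ C := fun y hy => (hC y hy).2
  have hmem : x ∈ Metric.ball x 1 := Metric.mem_ball_self one_pos
  obtain ⟨hHint, hHderiv⟩ := hasDerivAt_integral_mul_kernel (x₀ := x) hg hgB
    (continuous_Hker μ ν t) (continuous_HkerDx μ ν t x) (hasDerivAt_Hker ht μ ν)
    (decay_Hker ht μ ν x) (decay_HkerDx ht μ ν x)
  rw [hHderiv.derivWithin_Ici hx]
  have hPint := ExpDecay.integrableOn_mul hg hgB (continuous_GkerPrim μ t x)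
    ((decay_GkerPrim ht μ x).single hmem)
  have hTint := ExpDecay.integrableOn_mul hg hgB (continuous_tailKer μ ν t x)
    ((decay_tailKer μ ν (T := t) (R := |x|)).single (i := (t, x)) ⟨⟨ht, le_rfl⟩, le_rfl⟩)
  have hfold := integral_Ioi_mul_phi_add_phi
    (q := fun y => derivWithin f (Ici 0) y * Real.exp (μ * y)) (Real.sqrt_pos.2 ht) x
    (integrable_gaussian_average hg hgB μ x (Real.sqrt t))
  have hpt : ∀ y, Real.exp (-μ * x - μ ^ 2 * t / 2) *
      (derivWithin f (Ici 0) y * Real.exp (μ * y) *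
        ((phi ((x - y) / Real.sqrt t) + phi ((x + y) / Real.sqrt t)) / Real.sqrt t)) =
      (-(derivWithin f (Ici 0) y * GkerPrim μ t x y) -
        derivWithin f (Ici 0) y * HkerDx μ ν t x y) +
        2 * (2 * ν - μ) * (derivWithin f (Ici 0) y * tailKer μ ν t x y) := fun y => by
    linear_combination (-derivWithin f (Ici 0) y) * neg_GkerPrim_sub_HkerDx ht μ ν x y
  rw [← hfold, ← integral_const_mul]
  simp_rw [hpt]
  have hPint' : IntegrableOn (fun y => -(derivWithin f (Ici 0) y * GkerPrim μ t x y)) (Ioi 0) :=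
    hPint.neg
  rw [integral_add, integral_sub hPint' hHint, integral_const_mul, integral_neg]
  · ring
  · exact hPint'.sub hHint
  · exact hTint.const_mul _

/-- although `∂_x u¹` and `∂_x u²` may fail to be continuous at
`(0,0)`, their difference converges to `f'(0)` as `(t,x) → (0,0)`. -/
theorem u1x_sub_u2x_continuous_at_origin (μ ν : ℝ) (f : ℝ → ℝ)
    (hf : IsInitialData f) :
    Filter.Tendsto
      (fun p : ℝ × ℝ =>
        derivWithin (fun x' => ∫ y in Set.Ioi (0 : ℝ), f y * Gker μ p.1 x' y)
          (Set.Ici 0) p.2 -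
        derivWithin (fun x' => ∫ y in Set.Ioi (0 : ℝ),
            derivWithin f (Set.Ici 0) y * Hker μ ν p.1 x' y) (Set.Ici 0) p.2)
      (nhdsWithin (0, 0) (Set.Ioi 0 ×ˢ Set.Ici 0))
      (nhds (derivWithin f (Set.Ici 0) 0)) := by
  have hg : ContinuousOn (derivWithin f (Ici 0)) (Ici 0) :=
    hf.1.continuousOn_derivWithin (uniqueDiffOn_Ici 0) le_rfl
  obtain ⟨C, hC⟩ := hf.2.1
  have hgB : ∀ y ∈ Ici (0 : ℝ), |derivWithin f (Ici 0) y| ≤ C := fun y hy => (hC y hy).2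
  have hexp : Tendsto (fun p : ℝ × ℝ => Real.exp (-μ * p.2 - μ ^ 2 * p.1 / 2))
      (nhdsWithin (0, 0) (Ioi 0 ×ˢ Ici 0)) (nhds 1) := by
    have := (by fun_prop : Continuous fun p : ℝ × ℝ =>
      Real.exp (-μ * p.2 - μ ^ 2 * p.1 / 2)).tendsto (0, 0)
    simp only [mul_zero, zero_div, sub_zero, Real.exp_zero] at this
    exact this.mono_left nhdsWithin_le_nhds
  have hlim := (hexp.mul (tendsto_gaussian_average hg hgB μ)).sub
    ((tendsto_integral_tailKer hg hgB μ ν).const_mul (2 * (2 * ν - μ)))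
  rw [one_mul, mul_zero, sub_zero] at hlim
  refine hlim.congr' ?_
  filter_upwards [self_mem_nhdsWithin] with p hp
  exact (derivWithin_sub_derivWithin_eq μ ν hf hp.1 hp.2).symm
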